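/- For every c ∈ ℝ^m⟨⟨X⟩⟩ there exists a unique series e ∈ ℝ^m⟨⟨X⟩⟩ satisfying the fixed-point equation e = (−c) ∘̃ e, and this same series e also satisfies c = (−e) ∘̃ c (equivalently, e ∘̃ c + c = 0); that is, the right composition inverse of δ + c is also a left composition inverse. -/

import Mathlib

open scoped BigOperators

/-- A word over the alphabet `X = {x_0, x_1, …, x_m}`. -/
abbrev Word (m : ℕ) := List (Fin (m+1))

/-- A formal power series in `ℝ⟨⟨X⟩⟩`. -/
abbrev Series (m : ℕ) := Word m → ℝ

/-- A formal power series in `ℝ^l⟨⟨X⟩⟩`. -/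
abbrev SeriesVec (l m : ℕ) := Fin l → Series m

/-- The shuffle product on `ℝ⟨⟨X⟩⟩`, defined via the coefficient recursion
`(c ⧢ d, x_i η) = (c^{x_i} ⧢ d, η) + (c ⧢ d^{x_i}, η)` which is the bilinear
extension of `(x_i η) ⧢ (x_j ξ) = x_i (η ⧢ (x_j ξ)) + x_j ((x_i η) ⧢ ξ)`. -/
def shuffle {m : ℕ} : Series m → Series m → Series m
  | c, d, [] => c [] * d []
  | c, d, i :: η => shuffle (fun w => c (i :: w)) d η + shuffle c (fun w => d (i :: w)) η

/-- `x_ℓ c` : prepend the letter `x_ℓ` to every word of `c`. -/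
def prepend {m : ℕ} (ℓ : Fin (m+1)) (c : Series m) : Series m
  | [] => 0
  | j :: w => if j = ℓ then c w else 0

/-- The left quotient `c^{x_ℓ}` : `(c^{x_ℓ}, η) = (c, x_ℓ η)`. -/
def leftQuot {m : ℕ} (ℓ : Fin (m+1)) (c : Series m) : Series m :=
  fun w => c (ℓ :: w)

/-- The series `1∅`. -/
def oneSeries {m : ℕ} : Series m := fun w => if w = [] then 1 else 0

/-- The constant series `K∅`. -/
def constSeries {m : ℕ} (K : ℝ) : Series m := fun w => if w = [] then K else 0

/-- The component `d_ℓ` of `d ∈ ℝ^m⟨⟨X⟩⟩` indexed by letters, with `d_0 := 0`. -/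
def dhat {m : ℕ} (d : Fin m → Series m) (ℓ : Fin (m+1)) : Series m :=
  Fin.cases (motive := fun _ => Series m) 0 d ℓ

/-- The component `d_ℓ` of `d ∈ ℝ^m⟨⟨X⟩⟩` indexed by letters, with `d_0 := 1`. -/
def dtil {m : ℕ} (d : Fin m → Series m) (ℓ : Fin (m+1)) : Series m :=
  Fin.cases (motive := fun _ => Series m) oneSeries d ℓ

/-- `φ_d(x_ℓ)(e) = x_ℓ e + x_0 (d_ℓ ⧢ e)` with `d_0 := 0`. -/
def phiLetter {m : ℕ} (d : Fin m → Series m) (ℓ : Fin (m+1)) (e : Series m) : Series m :=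
  prepend ℓ e + prepend 0 (shuffle (dhat d ℓ) e)

/-- `φ_d(η)` for a word `η`, with `φ_d(∅) = id` and `φ_d(x_ℓ η) = φ_d(x_ℓ) ∘ φ_d(η)`. -/
def phi {m : ℕ} (d : Fin m → Series m) : Word m → Series m → Series m
  | [], e => e
  | ℓ :: η, e => phiLetter d ℓ (phi d η e)

/-- The modified composition product `c ∘̃ d = Σ_{η ∈ X*} (c, η) φ_d(η)(1)`.
Since `φ_d(η)(1)` has no words of length `< |η|`, the coefficient of a word `ν`
is given by the (finite) sum over all words `η` with `|η| ≤ |ν|`. -/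
def modComp {m : ℕ} (c : Series m) (d : Fin m → Series m) : Series m :=
  fun ν => ∑ k ∈ Finset.range (ν.length + 1), ∑ η : Fin k → Fin (m+1),
    c (List.ofFn η) * phi d (List.ofFn η) oneSeries ν

/-- The modified composition product on `ℝ^l⟨⟨X⟩⟩`, componentwise. -/
def modCompVec {l m : ℕ} (c : SeriesVec l m) (d : SeriesVec m m) : SeriesVec l m :=
  fun i => modComp (c i) d

/-- `ψ_d(x_ℓ)(e) = x_0 (d_ℓ ⧢ e)` with `d_0 := 1`. -/
def psiLetter {m : ℕ} (d : Fin m → Series m) (ℓ : Fin (m+1)) (e : Series m) : Series m :=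
  prepend 0 (shuffle (dtil d ℓ) e)

/-- `ψ_d(η)` for a word `η`, with `ψ_d(∅) = id` and `ψ_d(x_ℓ η) = ψ_d(x_ℓ) ∘ ψ_d(η)`. -/
def psi {m : ℕ} (d : Fin m → Series m) : Word m → Series m → Series m
  | [], e => e
  | ℓ :: η, e => psiLetter d ℓ (psi d η e)

/-- The composition product `c ∘ d = Σ_{η ∈ X*} (c, η) ψ_d(η)(1)`. -/
def comp {m : ℕ} (c : Series m) (d : Fin m → Series m) : Series m :=
  fun ν => ∑ k ∈ Finset.range (ν.length + 1), ∑ η : Fin k → Fin (m+1),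
    c (List.ofFn η) * psi d (List.ofFn η) oneSeries ν

/-- The composition product on `ℝ^l⟨⟨X⟩⟩`, componentwise. -/
def compVec {l m : ℕ} (c : SeriesVec l m) (d : SeriesVec m m) : SeriesVec l m :=
  fun i => comp (c i) d

/-- The group product `c ⊚ d := d + c ∘̃ d` of the output feedback group,
so that `(δ + c) ∘ (δ + d) = δ + c ⊚ d`. -/
def oplus {m : ℕ} (c d : SeriesVec m m) : SeriesVec m m :=
  d + modCompVec c d

/-! ### The shuffle algebra -/

theorem leftQuot_add {m : ℕ} (i : Fin (m+1)) (a b : Series m) :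
    leftQuot i (a + b) = leftQuot i a + leftQuot i b := rfl

theorem shuffle_cons {m : ℕ} (a b : Series m) (i : Fin (m+1)) (w : Word m) :
    shuffle a b (i :: w) = shuffle (leftQuot i a) b w + shuffle a (leftQuot i b) w := by
  rw [shuffle]; rfl

theorem leftQuot_shuffle {m : ℕ} (a b : Series m) (i : Fin (m+1)) :
    leftQuot i (shuffle a b) = shuffle (leftQuot i a) b + shuffle a (leftQuot i b) :=
  funext fun w => shuffle_cons a b i w

theorem shuffle_comm {m : ℕ} (a b : Series m) : shuffle a b = shuffle b a := by
  funext w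
  induction w generalizing a b with
  | nil => simp only [shuffle, mul_comm]
  | cons i w ih => rw [shuffle_cons, shuffle_cons, ih, ih a, add_comm]

theorem shuffle_add {m : ℕ} (a b c : Series m) :
    shuffle a (b + c) = shuffle a b + shuffle a c := by
  funext w
  induction w generalizing a b c with
  | nil => simp only [shuffle, Pi.add_apply, mul_add]
  | cons i w ih =>
    rw [Pi.add_apply, shuffle_cons, shuffle_cons, shuffle_cons, leftQuot_add, ih, ih,
      Pi.add_apply, Pi.add_apply]
    ring

theorem add_shuffle {m : ℕ} (a b c : Series m) :
    shuffle (a + b) c = shuffle a c + shuffle b c := by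
  rw [shuffle_comm, shuffle_add, shuffle_comm c a, shuffle_comm c b]

theorem shuffle_smul {m : ℕ} (r : ℝ) (a b : Series m) :
    shuffle a (r • b) = r • shuffle a b := by
  funext w
  induction w generalizing a b with
  | nil => simp only [shuffle, Pi.smul_apply, smul_eq_mul]; ring
  | cons i w ih =>
    have h : leftQuot i (r • b) = r • leftQuot i b := rfl
    rw [Pi.smul_apply, shuffle_cons, shuffle_cons, h, ih, ih, Pi.smul_apply, Pi.smul_apply,
      smul_add]

/-- Shuffling with a fixed series, as a linear map. -/
def shuffleLin {m : ℕ} (a : Series m) : Series m →ₗ[ℝ] Series m where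
  toFun := shuffle a
  map_add' := shuffle_add a
  map_smul' r := shuffle_smul r a

theorem shuffle_sum {m : ℕ} {ι : Type*} (s : Finset ι) (a : Series m) (f : ι → Series m) :
    shuffle a (∑ i ∈ s, f i) = ∑ i ∈ s, shuffle a (f i) :=
  map_sum (shuffleLin a) f s

theorem shuffle_zero {m : ℕ} (a : Series m) : shuffle a 0 = 0 :=
  map_zero (shuffleLin a)

theorem zero_shuffle {m : ℕ} (a : Series m) : shuffle 0 a = 0 := by
  rw [shuffle_comm, shuffle_zero]

theorem shuffle_assoc {m : ℕ} (a b c : Series m) :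
    shuffle (shuffle a b) c = shuffle a (shuffle b c) := by
  funext w
  induction w generalizing a b c with
  | nil => simp only [shuffle, mul_assoc]
  | cons i w ih =>
    rw [shuffle_cons, shuffle_cons, leftQuot_shuffle, leftQuot_shuffle, add_shuffle, shuffle_add,
      Pi.add_apply, Pi.add_apply, ih, ih, ih, add_assoc]

theorem shuffle_left_comm {m : ℕ} (a b c : Series m) :
    shuffle a (shuffle b c) = shuffle b (shuffle a c) := by
  rw [← shuffle_assoc, shuffle_comm a b, shuffle_assoc]

/-! ### Agreement of series up to a given word length -/

/-- The series `a` and `b` have the same coefficients on words of length at most `n`. -/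
def AgreeUpTo {m : ℕ} (n : ℕ) (a b : Series m) : Prop :=
  ∀ w : Word m, w.length ≤ n → a w = b w

theorem AgreeUpTo.mono {m k n : ℕ} {a b : Series m} (h : AgreeUpTo n a b) (hk : k ≤ n) :
    AgreeUpTo k a b :=
  fun w hw => h w (hw.trans hk)

theorem AgreeUpTo.leftQuot {m n : ℕ} {a b : Series m} (h : AgreeUpTo (n+1) a b)
    (i : Fin (m+1)) : AgreeUpTo n (leftQuot i a) (leftQuot i b) :=
  fun w hw => h (i :: w) (by simpa using hw)

theorem AgreeUpTo.shuffle {m n : ℕ} {a a' b b' : Series m} (ha : AgreeUpTo n a a')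
    (hb : AgreeUpTo n b b') : AgreeUpTo n (shuffle a b) (shuffle a' b') := by
  intro w hw
  induction w generalizing n a a' b b' with
  | nil => simp only [_root_.shuffle, ha [] hw, hb [] hw]
  | cons i w ih =>
    obtain _ | n := n
    · simp at hw
    · have hw' : w.length ≤ n := by simpa using hw
      rw [shuffle_cons, shuffle_cons, ih (ha.leftQuot i) (hb.mono n.le_succ) hw',
        ih (ha.mono n.le_succ) (hb.leftQuot i) hw']

theorem AgreeUpTo.shuffle_right {m n : ℕ} {b b' : Series m} (a : Series m)
    (hb : AgreeUpTo n b b') : AgreeUpTo n (_root_.shuffle a b) (_root_.shuffle a b') :=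
  AgreeUpTo.shuffle (fun _ _ => rfl) hb

/-! ### The left quotients of a modified composition product -/

theorem phi_oneSeries_eq_zero {m : ℕ} (d : Fin m → Series m) (η ν : Word m)
    (h : ν.length < η.length) : phi d η oneSeries ν = 0 := by
  induction η generalizing ν with
  | nil => simp at h
  | cons i η ih =>
    cases ν with
    | nil => simp [phi, phiLetter, prepend]
    | cons j w =>
      have hw : w.length < η.length := by simpa using h
      have hs : shuffle (dhat d i) (phi d η oneSeries) w = 0 := by
        have := AgreeUpTo.shuffle_right (n := w.length) (b := phi d η oneSeries) (b' := 0)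
          (dhat d i) (fun v hv => ih v (hv.trans_lt hw)) w le_rfl
        rw [this, shuffle_zero, Pi.zero_apply]
      simp [phi, phiLetter, prepend, ih w hw, hs]

theorem modComp_nil {m : ℕ} (c : Series m) (d : Fin m → Series m) : modComp c d [] = c [] := by
  simp [modComp, phi, oneSeries]

/-- The sum defining `modComp` may be cut off at any sufficiently large length. -/
theorem modComp_agreeUpTo {m : ℕ} (c : Series m) (d : Fin m → Series m) (n : ℕ) :
    AgreeUpTo n (modComp c d) (∑ k ∈ Finset.range (n + 1), ∑ η : Fin k → Fin (m+1),
      c (List.ofFn η) • phi d (List.ofFn η) oneSeries) := by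
  intro w hw
  simp only [Finset.sum_apply, Pi.smul_apply, smul_eq_mul, modComp]
  apply Finset.sum_subset (by simpa using hw)
  intro k _ hk
  apply Finset.sum_eq_zero
  intro η _
  rw [phi_oneSeries_eq_zero, mul_zero]
  simp at hk ⊢
  omega

theorem modComp_cons {m : ℕ} (c : Series m) (d : Fin m → Series m) (j : Fin (m+1)) (w : Word m) :
    modComp c d (j :: w) = modComp (leftQuot j c) d w +
      if j = 0 then ∑ i, shuffle (dhat d i) (modComp (leftQuot i c) d) w else 0 := by
  have hs (i : Fin (m+1)) : shuffle (dhat d i) (modComp (leftQuot i c) d) w =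
      ∑ k ∈ Finset.range (w.length + 1), ∑ η : Fin k → Fin (m+1),
        c (i :: List.ofFn η) * shuffle (dhat d i) (phi d (List.ofFn η) oneSeries) w := by
    rw [(modComp_agreeUpTo (leftQuot i c) d w.length).shuffle_right (dhat d i) w le_rfl]
    simp only [shuffle_sum, shuffle_smul, Finset.sum_apply, Pi.smul_apply, smul_eq_mul, leftQuot]
  have hk (k : ℕ) : ∑ η : Fin (k+1) → Fin (m+1),
      c (List.ofFn η) * phi d (List.ofFn η) oneSeries (j :: w) =
      ∑ η : Fin k → Fin (m+1), c (j :: List.ofFn η) * phi d (List.ofFn η) oneSeries w +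
      ∑ i, ∑ η : Fin k → Fin (m+1), if j = 0 then
        c (i :: List.ofFn η) * shuffle (dhat d i) (phi d (List.ofFn η) oneSeries) w else 0 := by
    have hcons (i : Fin (m+1)) (η : Fin k → Fin (m+1)) :
        List.ofFn ((Fin.consEquiv fun _ => Fin (m+1)) (i, η)) = i :: List.ofFn η :=
      List.ofFn_cons i η
    rw [← (Fin.consEquiv fun _ => Fin (m+1)).sum_comp, Fintype.sum_prod_type]
    simp only [hcons, phi, phiLetter, Pi.add_apply, prepend, mul_add,
      Finset.sum_add_distrib, mul_ite, mul_zero]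
    congr 1
    rw [Finset.sum_comm]
    simp
  rw [modComp, List.length_cons, Finset.sum_range_succ']
  simp only [hk, hs, Finset.sum_add_distrib]
  rw [Finset.sum_comm (s := Finset.range (w.length + 1)) (t := Finset.univ)]
  split_ifs <;> simp [modComp, leftQuot, phi, oneSeries]

theorem leftQuot_modComp_zero {m : ℕ} (c : Series m) (d : Fin m → Series m) :
    leftQuot 0 (modComp c d) = modComp (leftQuot 0 c) d +
      ∑ i, shuffle (dhat d i) (modComp (leftQuot i c) d) := by
  funext w
  simp [leftQuot, modComp_cons]

theorem leftQuot_modComp_of_ne {m : ℕ} (c : Series m) (d : Fin m → Series m) {j : Fin (m+1)}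
    (hj : j ≠ 0) : leftQuot j (modComp c d) = modComp (leftQuot j c) d := by
  funext w
  simp [leftQuot, modComp_cons, hj]

/-! ### Algebraic properties of the modified composition product -/

theorem add_modComp {m : ℕ} (a b : Series m) (d : Fin m → Series m) :
    modComp (a + b) d = modComp a d + modComp b d := by
  funext w
  simp [modComp, add_mul, Finset.sum_add_distrib]

theorem smul_modComp {m : ℕ} (r : ℝ) (a : Series m) (d : Fin m → Series m) :
    modComp (r • a) d = r • modComp a d := by
  funext w
  simp [modComp, Finset.mul_sum, mul_assoc]

/-- Modified composition with a fixed right factor, as a linear map. -/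
def modCompLin {m : ℕ} (d : Fin m → Series m) : Series m →ₗ[ℝ] Series m where
  toFun c := modComp c d
  map_add' a b := add_modComp a b d
  map_smul' r a := smul_modComp r a d

theorem neg_modComp {m : ℕ} (a : Series m) (d : Fin m → Series m) :
    modComp (-a) d = -modComp a d :=
  map_neg (modCompLin d) a

theorem zero_modComp {m : ℕ} (d : Fin m → Series m) : modComp (0 : Series m) d = 0 :=
  map_zero (modCompLin d)

theorem sum_modComp {m : ℕ} {ι : Type*} (s : Finset ι) (f : ι → Series m)
    (d : Fin m → Series m) : modComp (∑ i ∈ s, f i) d = ∑ i ∈ s, modComp (f i) d :=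
  map_sum (modCompLin d) f s

theorem dhat_zero {m : ℕ} (i : Fin (m+1)) : dhat (0 : Fin m → Series m) i = 0 := by
  cases i using Fin.cases <;> rfl

theorem dhat_add {m : ℕ} (d e : Fin m → Series m) (i : Fin (m+1)) :
    dhat (d + e) i = dhat d i + dhat e i := by
  cases i using Fin.cases with
  | zero => exact (add_zero 0).symm
  | succ i => rfl

theorem dhat_modCompVec {m : ℕ} (d e : SeriesVec m m) (i : Fin (m+1)) :
    dhat (modCompVec d e) i = modComp (dhat d i) e := by
  cases i using Fin.cases with
  | zero => exact (zero_modComp e).symm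
  | succ i => rfl

theorem modComp_zero {m : ℕ} (c : Series m) : modComp c 0 = c := by
  funext w
  induction w generalizing c with
  | nil => exact modComp_nil c 0
  | cons j w ih => simp [modComp_cons, dhat_zero, zero_shuffle, ih, leftQuot]

theorem shuffle_modComp {m : ℕ} (a b : Series m) (d : Fin m → Series m) :
    modComp (shuffle a b) d = shuffle (modComp a d) (modComp b d) := by
  suffices h : ∀ n, ∀ a b : Series m,
      AgreeUpTo n (modComp (shuffle a b) d) (shuffle (modComp a d) (modComp b d)) from
    funext fun w => h w.length a b w le_rfl
  intro n
  induction n with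
  | zero =>
    intro a b w hw
    obtain rfl : w = [] := by simpa using hw
    simp only [modComp_nil, shuffle]
  | succ n ih =>
    rintro a b (_ | ⟨j, w⟩) hw
    · simp only [modComp_nil, shuffle]
    have hw' : w.length ≤ n := by simpa using hw
    rw [shuffle_cons]
    change leftQuot j (modComp (shuffle a b) d) w = _
    by_cases hj : j = 0
    · subst hj
      have hs (i : Fin (m+1)) :
          shuffle (dhat d i) (modComp (leftQuot i (shuffle a b)) d) w =
          shuffle (shuffle (dhat d i) (modComp (leftQuot i a) d)) (modComp b d) w +
          shuffle (modComp a d) (shuffle (dhat d i) (modComp (leftQuot i b) d)) w := by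
        rw [leftQuot_shuffle, add_modComp, shuffle_add, Pi.add_apply,
          (ih _ _).shuffle_right _ w hw', (ih _ _).shuffle_right _ w hw', shuffle_assoc,
          shuffle_left_comm (modComp a d)]
      simp only [leftQuot_modComp_zero, Pi.add_apply, Finset.sum_apply, hs, add_shuffle,
        shuffle_add, shuffle_sum, Finset.sum_add_distrib]
      rw [leftQuot_shuffle, add_modComp, Pi.add_apply, ih _ _ w hw', ih _ _ w hw',
        shuffle_comm (∑ i, _) (modComp b d), shuffle_sum, Finset.sum_apply]
      simp only [shuffle_comm (modComp b d)]
      ring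
    · simp only [leftQuot_modComp_of_ne _ _ hj, leftQuot_shuffle, add_modComp, Pi.add_apply,
        ih _ _ w hw']

theorem modComp_modComp {m : ℕ} (c : Series m) (d e : SeriesVec m m) :
    modComp (modComp c d) e = modComp c (oplus d e) := by
  suffices h : ∀ n, ∀ c : Series m,
      AgreeUpTo n (modComp (modComp c d) e) (modComp c (oplus d e)) from
    funext fun w => h w.length c w le_rfl
  intro n
  induction n with
  | zero =>
    intro c w hw
    obtain rfl : w = [] := by simpa using hw
    simp only [modComp_nil]
  | succ n ih =>
    rintro c (_ | ⟨j, w⟩) hw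
    · simp only [modComp_nil]
    have hw' : w.length ≤ n := by simpa using hw
    change leftQuot j (modComp (modComp c d) e) w = leftQuot j (modComp c (oplus d e)) w
    by_cases hj : j = 0
    · subst hj
      have hs (i : Fin (m+1)) :
          shuffle (dhat e i) (modComp (leftQuot i (modComp c d)) e) =
          shuffle (dhat e i) (modComp (modComp (leftQuot i c) d) e) := by
        by_cases hi : i = 0
        · subst hi
          have h0 : dhat e 0 = 0 := rfl
          rw [h0, zero_shuffle, zero_shuffle]
        · rw [leftQuot_modComp_of_ne _ _ hi]
      rw [leftQuot_modComp_zero, leftQuot_modComp_zero c (oplus d e)]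
      simp only [hs, leftQuot_modComp_zero, add_modComp, sum_modComp, shuffle_modComp, oplus,
        dhat_add, dhat_modCompVec, add_shuffle, Pi.add_apply, Finset.sum_apply,
        Finset.sum_add_distrib]
      have ih' := fun i => ih (leftQuot i c)
      simp only [oplus] at ih'
      simp only [ih' _ w hw', (ih' _).shuffle_right _ w hw']
      ring
    · rw [leftQuot_modComp_of_ne _ _ hj, leftQuot_modComp_of_ne _ _ hj,
        leftQuot_modComp_of_ne _ _ hj, ih _ w hw']

/-! ### The output feedback group -/

theorem oplus_assoc {m : ℕ} (c d e : SeriesVec m m) :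
    oplus (oplus c d) e = oplus c (oplus d e) := by
  funext i
  change e i + modComp (d i + modComp (c i) d) e =
    (e i + modComp (d i) e) + modComp (c i) (oplus d e)
  rw [add_modComp, modComp_modComp, add_assoc]

theorem oplus_zero {m : ℕ} (c : SeriesVec m m) : oplus c 0 = c := by
  funext i
  change 0 + modComp (c i) 0 = c i
  rw [zero_add, modComp_zero]

theorem zero_oplus {m : ℕ} (c : SeriesVec m m) : oplus 0 c = c := by
  funext i
  change c i + modComp 0 c = c i
  rw [zero_modComp, add_zero]

theorem AgreeUpTo.dhat {m n : ℕ} {d d' : Fin m → Series m} (h : ∀ i, AgreeUpTo n (d i) (d' i))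
    (i : Fin (m+1)) : AgreeUpTo n (dhat d i) (dhat d' i) := by
  cases i using Fin.cases with
  | zero => exact fun _ _ => rfl
  | succ i => exact h i

/-- `d ↦ c ∘̃ d` is a contraction: it gains one order of agreement. -/
theorem AgreeUpTo.modComp_succ {m n : ℕ} {d d' : Fin m → Series m}
    (h : ∀ i, AgreeUpTo n (d i) (d' i)) (c : Series m) :
    AgreeUpTo (n+1) (modComp c d) (modComp c d') := by
  suffices H : ∀ k ≤ n + 1, ∀ c : Series m, AgreeUpTo k (modComp c d) (modComp c d') from
    H _ le_rfl c
  intro k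
  induction k with
  | zero =>
    intro _ c w hw
    obtain rfl : w = [] := by simpa using hw
    simp only [modComp_nil]
  | succ k ih =>
    rintro hk c (_ | ⟨j, w⟩) hw
    · simp only [modComp_nil]
    have hw' : w.length ≤ k := by simpa using hw
    have hd (i : Fin (m+1)) : AgreeUpTo k (_root_.dhat d i) (_root_.dhat d' i) :=
      (AgreeUpTo.dhat h i).mono (by omega)
    have ih' := ih (by omega)
    simp only [modComp_cons, ih' _ w hw', ((hd _).shuffle (ih' _)) w hw']

theorem modCompVec_fixedPoint_unique {m : ℕ} {c e e' : SeriesVec m m}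
    (he : e = modCompVec c e) (he' : e' = modCompVec c e') : e' = e := by
  have h (n : ℕ) : ∀ i, AgreeUpTo n (e' i) (e i) := by
    induction n with
    | zero =>
      intro i w hw
      obtain rfl : w = [] := by simpa using hw
      rw [he, he']
      simp only [modCompVec, modComp_nil]
    | succ n ih =>
      intro i
      rw [he, he']
      exact AgreeUpTo.modComp_succ ih (c i)
  exact funext fun i => funext fun w => h w.length i w le_rfl

theorem exists_modCompVec_fixedPoint {m : ℕ} (c : SeriesVec m m) :
    ∃ e : SeriesVec m m, e = modCompVec c e := by
  let E : ℕ → SeriesVec m m := fun n => (modCompVec c)^[n] 0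
  have hE (n : ℕ) : E (n+1) = modCompVec c (E n) := Function.iterate_succ_apply' _ _ _
  have hstep (n : ℕ) : ∀ i, AgreeUpTo n (E (n+1) i) (E (n+2) i) := by
    induction n with
    | zero =>
      intro i w hw
      obtain rfl : w = [] := by simpa using hw
      rw [hE, hE]
      simp only [modCompVec, modComp_nil]
    | succ n ih =>
      intro i
      rw [hE, hE (n+2)]
      exact AgreeUpTo.modComp_succ ih (c i)
  have hmono (n k : ℕ) (hk : n ≤ k) (i : Fin m) : AgreeUpTo n (E (n+1) i) (E (k+1) i) := by
    induction k, hk using Nat.le_induction with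
    | base => exact fun _ _ => rfl
    | succ k hk ih => exact fun w hw => (ih w hw).trans (hstep k i w (hw.trans hk))
  let e : SeriesVec m m := fun i w => E (w.length + 1) i w
  have he (n : ℕ) (i : Fin m) : AgreeUpTo n (e i) (E (n+1) i) :=
    fun w hw => hmono w.length n hw i w le_rfl
  refine ⟨e, funext fun i => funext fun w => ?_⟩
  have h := AgreeUpTo.modComp_succ (he w.length) (c i) w (Nat.le_succ _)
  change e i w = modComp (c i) e w
  rw [h]
  change _ = modCompVec c (E (w.length + 1)) i w
  rw [← hE]
  exact hstep w.length i w le_rfl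

theorem neg_modCompVec {l m : ℕ} (c : SeriesVec l m) (d : SeriesVec m m) :
    modCompVec (-c) d = -modCompVec c d :=
  funext fun i => neg_modComp (c i) d

theorem eq_neg_modCompVec_iff {m : ℕ} (c e : SeriesVec m m) :
    e = modCompVec (-c) e ↔ oplus c e = 0 := by
  rw [neg_modCompVec, oplus, eq_neg_iff_add_eq_zero]

/-- A right inverse in the output feedback group is a left inverse. -/
theorem oplus_eq_zero_symm {m : ℕ} {c e : SeriesVec m m} (h : oplus c e = 0) :
    oplus e c = 0 := by
  obtain ⟨f, hf⟩ := exists_modCompVec_fixedPoint (-e)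
  rw [eq_neg_modCompVec_iff] at hf
  have hcf : c = f := by
    rw [← oplus_zero c, ← hf, ← oplus_assoc, h, zero_oplus]
  rwa [hcf]

/-- for every `c ∈ ℝ^m⟨⟨X⟩⟩` there is a unique `e` with
`e = (−c) ∘̃ e`, and this same `e` also satisfies `c = (−e) ∘̃ c`
(equivalently `e ∘̃ c + c = 0`). -/
theorem rightInverseIsLeftInverse (m : ℕ) (c : SeriesVec m m) :
    ∃ e : SeriesVec m m,
      e = modCompVec (-c) e ∧
      (∀ e' : SeriesVec m m, e' = modCompVec (-c) e' → e' = e) ∧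
      c = modCompVec (-e) c ∧
      modCompVec e c + c = 0 := by
  obtain ⟨e, he⟩ := exists_modCompVec_fixedPoint (-c)
  have hec : oplus e c = 0 := oplus_eq_zero_symm ((eq_neg_modCompVec_iff c e).1 he)
  exact ⟨e, he, fun e' he' => modCompVec_fixedPoint_unique he he',
    (eq_neg_modCompVec_iff e c).2 hec, by rwa [oplus, add_comm] at hec⟩
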